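/- Let (Ω, F, P) be a probability space with filtration (F_t)_{t∈ℕ}, and let (m_t)_{t≥1} and (R_t)_{t≥1} be positive adapted processes with m_t R_t integrable and E[m_t R_t | F_{t−1}] = 1 almost surely for all t. Assume: (i) there exists L > 0 with E[(log(m_t R_t) − E[log(m_t R_t) | F_{t−1}])²] ≤ L for all t; and (ii) the long-term entropy z_∞(mR) = lim_{n→∞} (1/n) ∑_{t=1}^{n} (log E[m_t R_t | F_{t−1}] − E[log(m_t R_t) | F_{t−1}]) = lim_{n→∞} −(1/n) ∑_{t=1}^{n} E[log(m_t R_t) | F_{t−1}] exists P-almost surely. Then (m_1 R_1 · m_2 R_2 ⋯ m_n R_n)^{1/n} → e^{−z_∞(mR)} P-almost surely as n → ∞. -/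

import Mathlib

open MeasureTheory Filter Finset
open scoped ENNReal NNReal

lemma kronecker_aux (d : ℕ → ℝ) (c : ℝ)
    (h : Tendsto (fun n => ∑ t ∈ range n, ((t : ℝ) + 1)⁻¹ * d t) atTop (nhds c)) :
    Tendsto (fun n : ℕ => (n : ℝ)⁻¹ * ∑ t ∈ range n, d t) atTop (nhds 0) := by
  set S : ℕ → ℝ := fun n => ∑ t ∈ range n, ((t : ℝ) + 1)⁻¹ * d t with hS
  have key : ∀ n : ℕ, ∑ t ∈ range n, d t = n * S n - ∑ t ∈ range n, S t := by
    intro n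
    induction n with
    | zero => simp
    | succ n ih =>
      have h1 : S (n + 1) = S n + ((n : ℝ) + 1)⁻¹ * d n := by simp [hS, sum_range_succ]
      rw [sum_range_succ, ih, sum_range_succ _ n, h1]
      have : (n : ℝ) + 1 ≠ 0 := by positivity
      push_cast
      field_simp
      ring
  have h2 : Tendsto (fun n : ℕ => S n - (n : ℝ)⁻¹ * ∑ t ∈ range n, S t) atTop (nhds (c - c)) :=
    h.sub h.cesaro
  rw [sub_self] at h2
  refine h2.congr' ?_
  filter_upwards [eventually_gt_atTop 0] with n hn
  rw [key]
  have : (n : ℝ) ≠ 0 := by positivity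
  field_simp

lemma slln_mds {Ω : Type*} {m0 : MeasurableSpace Ω} (μ : Measure Ω) [IsProbabilityMeasure μ]
    (ℱ : Filtration ℕ m0) (D : ℕ → Ω → ℝ) (L : ℝ)
    (hD : ∀ t, StronglyMeasurable[ℱ (t + 1)] (D t)) (hL2 : ∀ t, MemLp (D t) 2 μ)
    (hE : ∀ t, μ[D t | ℱ t] =ᵐ[μ] 0) (hb : ∀ t, ∫ ω, D t ω ^ 2 ∂μ ≤ L) :
    ∀ᵐ ω ∂μ, Tendsto (fun n : ℕ => (n : ℝ)⁻¹ * ∑ t ∈ range n, D t ω) atTop (nhds 0) := by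
  have hL : 0 ≤ L := le_trans (integral_nonneg fun ω => sq_nonneg _) (hb 0)
  set S : ℕ → Ω → ℝ := fun n ω => ∑ t ∈ range n, ((t : ℝ) + 1)⁻¹ * D t ω with hS
  have hSsucc : ∀ n, S (n + 1) = fun ω => S n ω + ((n : ℝ) + 1)⁻¹ * D n ω := by
    intro n; ext ω; simp [hS, sum_range_succ]
  have hSm : ∀ n, StronglyMeasurable[ℱ n] (S n) := by
    intro n
    refine Finset.stronglyMeasurable_fun_sum _ fun t ht => ?_
    exact ((hD t).mono (ℱ.mono (by have := Finset.mem_range.1 ht; omega))).const_mul _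
  have hS2 : ∀ n, MemLp (S n) 2 μ := by
    intro n
    exact memLp_finsetSum _ fun t _ => (hL2 t).const_mul _
  have hSi : ∀ n, Integrable (S n) μ := fun n => (hS2 n).integrable (by norm_num)
  have hDi : ∀ n, Integrable (D n) μ := fun n => (hL2 n).integrable (by norm_num)
  have hmart : Martingale S ℱ μ := by
    refine martingale_of_condExp_sub_eq_zero_nat hSm hSi fun n => ?_
    have : S (n + 1) - S n = ((n : ℝ) + 1)⁻¹ • D n := by
      rw [hSsucc]; ext ω; simp
    rw [this]
    filter_upwards [condExp_smul (μ := μ) (((n : ℝ) + 1)⁻¹) (D n) (ℱ n), hE n] with ω h1 h2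
    rw [h1]; simp [h2]
  have hcross : ∀ n, ∫ ω, (S n * D n) ω ∂μ = 0 := by
    intro n
    rw [← integral_condExp (ℱ.le n)]
    have h1 := condExp_mul_of_stronglyMeasurable_left (hSm n) ((hS2 n).integrable_mul (hL2 n))
      (hDi n)
    rw [integral_congr_ae (g := fun _ => (0 : ℝ))]
    · simp
    · filter_upwards [h1, hE n] with ω a b
      rw [a]; simp [b]
  have hsq : ∀ n, ∫ ω, S n ω ^ 2 ∂μ ≤ L * ∑ t ∈ range n, (((t : ℝ) + 1)⁻¹) ^ 2 := by
    intro n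
    induction n with
    | zero => simp [hS]
    | succ n ih =>
      rw [hSsucc]
      have e : ∀ ω, (S n ω + ((n : ℝ) + 1)⁻¹ * D n ω) ^ 2 =
          (S n ω ^ 2 + (2 * ((n : ℝ) + 1)⁻¹) * (S n * D n) ω)
            + (((n : ℝ) + 1)⁻¹) ^ 2 * D n ω ^ 2 := by
        intro ω; simp only [Pi.mul_apply]; ring
      simp_rw [e]
      have i1 := (hS2 n).integrable_sq
      have i2 := ((hS2 n).integrable_mul (hL2 n)).const_mul (2 * ((n : ℝ) + 1)⁻¹)
      have i3 := ((hL2 n).integrable_sq).const_mul ((((n : ℝ) + 1)⁻¹) ^ 2)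
      have i12 : Integrable (fun ω => S n ω ^ 2 + (2 * ((n : ℝ) + 1)⁻¹) * (S n * D n) ω) μ :=
        i1.add i2
      rw [integral_add i12 i3, integral_add i1 i2, integral_const_mul, integral_const_mul,
        hcross, sum_range_succ]
      have := mul_le_mul_of_nonneg_left (hb n) (sq_nonneg (((n : ℝ) + 1)⁻¹))
      linarith
  have hsum : Summable fun t : ℕ => (((t : ℝ) + 1)⁻¹) ^ 2 := by
    have h := (summable_nat_add_iff 1).2 (Real.summable_nat_pow_inv.2 (by norm_num : 1 < 2))
    simpa using h
  set C : ℝ := ∑' t : ℕ, (((t : ℝ) + 1)⁻¹) ^ 2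
  have hbd : ∀ n, eLpNorm (S n) 1 μ ≤ ((1 + L * C).toNNReal : ℝ≥0∞) := by
    intro n
    rw [eLpNorm_one_eq_lintegral_enorm, ← ofReal_integral_norm_eq_lintegral_enorm (hSi n)]
    refine ENNReal.ofReal_le_ofReal ?_
    have h1 : ∫ ω, ‖S n ω‖ ∂μ ≤ ∫ ω, (1 + S n ω ^ 2) ∂μ := by
      refine integral_mono (hSi n).norm ((integrable_const _).add (hS2 n).integrable_sq) fun ω => ?_
      simp only [Real.norm_eq_abs]
      nlinarith [sq_abs (S n ω), sq_nonneg (|S n ω| - 1)]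
    rw [integral_add (integrable_const _) (hS2 n).integrable_sq] at h1
    simp only [integral_const, probReal_univ, smul_eq_mul, mul_one] at h1
    have h2 := hsum.sum_le_tsum (range n) (fun t _ => sq_nonneg _)
    have h3 := mul_le_mul_of_nonneg_left h2 hL
    have h4 := hsq n
    linarith
  filter_upwards [hmart.submartingale.exists_ae_tendsto_of_bdd hbd] with ω ⟨c, hc⟩
  exact kronecker_aux _ c hc

/-- Long-dated valuation: the geometric average of the risk-adjusted returns
converges almost surely to `exp(-z∞(mR))`, where `z∞(mR)` is the long-term entropy
of the risk-adjusted return process. -/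
theorem geometric_average_risk_adjusted_return
    {Ω : Type*} {m0 : MeasurableSpace Ω} (μ : Measure Ω) [IsProbabilityMeasure μ]
    (ℱ : Filtration ℕ m0) (m R : ℕ → Ω → ℝ)
    (hadpm : Adapted ℱ m) (hadpR : Adapted ℱ R)
    (hmpos : ∀ t, ∀ᵐ ω ∂μ, 0 < m t ω) (hRpos : ∀ t, ∀ᵐ ω ∂μ, 0 < R t ω)
    (hint : ∀ t, Integrable (fun ω => m t ω * R t ω) μ)
    (hpricing : ∀ t, 1 ≤ t →
      (μ[fun ω => m t ω * R t ω | ℱ (t - 1)]) =ᵐ[μ] fun _ => 1)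
    (L : ℝ) (hL : 0 < L)
    (hvar : ∀ t, 1 ≤ t →
      ∫⁻ ω, (‖Real.log (m t ω * R t ω) -
        (μ[fun ω' => Real.log (m t ω' * R t ω') | ℱ (t - 1)]) ω‖₊ : ℝ≥0∞) ^ 2 ∂μ
        ≤ ENNReal.ofReal L)
    (z : Ω → ℝ)
    (hz : ∀ᵐ ω ∂μ, Tendsto
      (fun n : ℕ => (1 / (n : ℝ)) * ∑ t ∈ Finset.Icc 1 n,
        (Real.log ((μ[fun ω' => m t ω' * R t ω' | ℱ (t - 1)]) ω) -
          (μ[fun ω' => Real.log (m t ω' * R t ω') | ℱ (t - 1)]) ω))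
      atTop (nhds (z ω))) :
    ∀ᵐ ω ∂μ, Tendsto
      (fun n : ℕ => (∏ t ∈ Finset.Icc 1 n, m t ω * R t ω) ^ (1 / (n : ℝ)))
      atTop (nhds (Real.exp (-z ω))) := by
  set X : ℕ → Ω → ℝ := fun t ω => Real.log (m t ω * R t ω) with hX
  have hXm : ∀ t, StronglyMeasurable[ℱ t] (X t) := fun t =>
    (Real.measurable_log.comp ((hadpm t).mul (hadpR t))).stronglyMeasurable
  have hce : ∀ t, StronglyMeasurable[ℱ t] (μ[X (t + 1) | ℱ t]) := fun t =>
    stronglyMeasurable_condExp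
  set D : ℕ → Ω → ℝ := fun t => X (t + 1) - μ[X (t + 1) | ℱ t] with hDdef
  have hDm : ∀ t, StronglyMeasurable[ℱ (t + 1)] (D t) := fun t =>
    (hXm (t + 1)).sub ((hce t).mono (ℱ.mono (Nat.le_succ t)))
  have hlin : ∀ t, ∫⁻ ω, ‖D t ω‖ₑ ^ 2 ∂μ ≤ ENNReal.ofReal L := fun t =>
    hvar (t + 1) (Nat.le_add_left 1 t)
  have hD2 : ∀ t, MemLp (D t) 2 μ := by
    intro t
    have haes : AEStronglyMeasurable (D t) μ := ((hDm t).mono (ℱ.le _)).aestronglyMeasurable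
    refine ⟨haes, ?_⟩
    rw [eLpNorm_lt_top_iff_lintegral_rpow_enorm_lt_top (by norm_num) (by norm_num)]
    refine lt_of_le_of_lt ?_ (lt_of_le_of_lt (hlin t) ENNReal.ofReal_lt_top)
    simp
  have hXi : ∀ t, Integrable (X (t + 1)) μ := by
    intro t
    by_contra hcon
    have h0 := condExp_of_not_integrable (m := ℱ t) hcon
    have h1 := (hD2 t).integrable (by norm_num)
    simp only [hDdef, h0, sub_zero] at h1
    exact hcon h1
  have hE : ∀ t, μ[D t | ℱ t] =ᵐ[μ] 0 := by
    intro t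
    have h1 := condExp_sub (hXi t) (integrable_condExp (f := X (t + 1)) (m := ℱ t) (μ := μ)) (ℱ t)
    rw [condExp_of_stronglyMeasurable (ℱ.le t) (hce t) integrable_condExp, sub_self] at h1
    exact h1
  have hb : ∀ t, ∫ ω, D t ω ^ 2 ∂μ ≤ L := by
    intro t
    rw [integral_eq_lintegral_of_nonneg_ae (ae_of_all _ fun ω => sq_nonneg _)
      (hD2 t).integrable_sq.aestronglyMeasurable]
    refine ENNReal.toReal_le_of_le_ofReal hL.le (le_trans (le_of_eq ?_) (hlin t))
    refine lintegral_congr fun ω => ?_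
    rw [← sq_abs, ENNReal.ofReal_pow (abs_nonneg _), ← Real.norm_eq_abs, ofReal_norm]
  have hp : ∀ᵐ ω ∂μ, ∀ t, 1 ≤ t → (μ[fun ω => m t ω * R t ω | ℱ (t - 1)]) ω = 1 := by
    rw [ae_all_iff]; intro t
    by_cases h : 1 ≤ t
    · filter_upwards [hpricing t h] with ω hω _ using hω
    · exact ae_of_all _ fun ω h' => absurd h' h
  filter_upwards [slln_mds μ ℱ D L hDm hD2 hE hb, hz, hp, ae_all_iff.2 hmpos, ae_all_iff.2 hRpos]
    with ω h1 h2 h3 h4 h5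
  have h6 := h1.sub h2
  rw [zero_sub] at h6
  refine ((Real.continuous_exp.tendsto _).comp h6).congr fun n => ?_
  have hpos : ∀ t, 0 < m t ω * R t ω := fun t => mul_pos (h4 t) (h5 t)
  simp only [Function.comp]
  rw [Real.rpow_def_of_pos (Finset.prod_pos fun t _ => hpos t),
    Real.log_prod (fun t _ => (hpos t).ne')]
  congr 1
  have e1 : ∑ t ∈ range n, D t ω = ∑ t ∈ Finset.Icc 1 n, (X t ω - (μ[X t | ℱ (t - 1)]) ω) := by
    clear h1 h2 h6
    induction n with
    | zero => simp
    | succ n ih =>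
      rw [sum_range_succ, ih, Finset.sum_Icc_succ_top (by omega)]
      simp [hDdef]
  have e2 : ∑ t ∈ Finset.Icc 1 n, (Real.log ((μ[fun ω' => m t ω' * R t ω' | ℱ (t - 1)]) ω) -
      (μ[X t | ℱ (t - 1)]) ω) = ∑ t ∈ Finset.Icc 1 n, (- (μ[X t | ℱ (t - 1)]) ω) := by
    refine Finset.sum_congr rfl fun t ht => ?_
    rw [h3 t (Finset.mem_Icc.1 ht).1]; simp
  rw [e1, e2, one_div, ← mul_sub, ← Finset.sum_sub_distrib, mul_comm]
  simp [hX]
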